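/- arXiv:1206.1781 — 4 statements merged into one kernel-verified Lean document; each statement's English description precedes it below -/
import Mathlib

section
/- Let A be a commutative ring, n ≥ 1 an integer, a_1, …, a_n ∈ A, and u ∈ A[[t]]. Set f = t·(1 + t^n·u), a unit of the Laurent series ring A((t)) (since t is a unit of A((t)) and 1 + t^n·u is a unit of A[[t]]). Then the difference Σ_{ℓ=1}^{n} a_ℓ·f^{-ℓ} − Σ_{ℓ=1}^{n} a_ℓ·t^{-ℓ} lies in A[[t]]. (Formal diffeomorphisms congruent to the identity modulo t^{n+1} act trivially on Laurent tails of order at most n.) -/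
open PowerSeries in
/-- If `v` has inverse `w` in `A⟦t⟧`, then `t⁻¹ w` is the inverse of `t v`
in `A⸨t⸩`. -/
theorem LaurentSeries.inverse_coe_X_mul {A : Type*} [CommRing A] {v w : PowerSeries A}
    (hvw : v * w = 1) :
    Ring.inverse ((X * v : PowerSeries A) : LaurentSeries A)
      = HahnSeries.single (-1 : ℤ) (1 : A) * (w : LaurentSeries A) := by
  have h : ((X * v : PowerSeries A) : LaurentSeries A)
      * (HahnSeries.single (-1 : ℤ) (1 : A) * (w : LaurentSeries A)) = 1 := by
    have h₁ : (HahnSeries.single (1 : ℤ) (1 : A)) * HahnSeries.single (-1 : ℤ) (1 : A) = 1 := by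
      simp [HahnSeries.single_mul_single]
    have h₂ : (v : LaurentSeries A) * (w : LaurentSeries A) = 1 := by
      rw [← coe_mul, hvw, coe_one]
    rw [coe_mul, coe_X, mul_mul_mul_comm, h₁, h₂, one_mul]
  exact Ring.inverse_unit (Units.mkOfMulEqOne _ _ h)

open PowerSeries in
/-- Multiplying a power series divisible by `tⁿ` by `a t⁻ˡ` with `ℓ ≤ n` gives a power series. -/
theorem LaurentSeries.single_neg_mul_coe_X_pow_mul {A : Type*} [CommRing A] {n ℓ : ℕ}
    (hℓ : ℓ ≤ n) (a : A) (h : PowerSeries A) :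
    HahnSeries.single (-(ℓ : ℤ)) a * ((X ^ n * h : PowerSeries A) : LaurentSeries A)
      = ((C a * X ^ (n - ℓ) * h : PowerSeries A) : LaurentSeries A) := by
  simp only [coe_mul, HahnSeries.ofPowerSeries_X_pow, coe_C, HahnSeries.C_apply, ← mul_assoc,
    HahnSeries.single_mul_single]
  congr 3
  push_cast [hℓ]
  ring

open PowerSeries in
/-- If `w` is inverse to `1 + tⁿ u`, then every power of `w` is congruent to `1` modulo `tⁿ`. -/
theorem PowerSeries.X_pow_dvd_pow_sub_one {A : Type*} [CommRing A] {n : ℕ} {u w : PowerSeries A}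
    (hw : (1 + X ^ n * u) * w = 1) (ℓ : ℕ) : X ^ n ∣ w ^ ℓ - 1 :=
  Dvd.dvd.trans ⟨-(u * w), by linear_combination hw⟩ (sub_one_dvd_pow_sub_one w ℓ)

/-- **Diffeomorphisms congruent to the identity mod `t^(n+1)` act trivially on Laurent
tails of order at most `n`.**  For a commutative ring `A`, `f = t(1 + tⁿ u)` is a unit of
`A⸨t⸩`, and `∑ aₗ f⁻ˡ - ∑ aₗ t⁻ˡ` lies in `A⟦t⟧`.  (Here `f⁻ˡ` is taken via
`Ring.inverse`, which is the genuine inverse since `f` is a unit.) -/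
theorem elsv_trivial_action_on_laurent_tails
    (A : Type*) [CommRing A] (n : ℕ) (hn : 1 ≤ n) (a : ℕ → A) (u : PowerSeries A) :
    ∃ g : PowerSeries A,
      (∑ ℓ ∈ Finset.Icc 1 n,
          HahnSeries.single (0 : ℤ) (a ℓ)
            * Ring.inverse
                ((PowerSeries.X * (1 + PowerSeries.X ^ n * u) : PowerSeries A) :
                  LaurentSeries A) ^ ℓ)
        - ∑ ℓ ∈ Finset.Icc 1 n, HahnSeries.single (-(ℓ : ℤ)) (a ℓ)
        = (g : LaurentSeries A) := by
  have hunit : IsUnit (1 + PowerSeries.X ^ n * u : PowerSeries A) := by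
    rw [PowerSeries.isUnit_iff_constantCoeff]
    simp [show n ≠ 0 by omega]
  obtain ⟨w, hw⟩ := hunit.exists_right_inv
  choose h hh using PowerSeries.X_pow_dvd_pow_sub_one hw
  refine ⟨∑ ℓ ∈ Finset.Icc 1 n,
    PowerSeries.C (a ℓ) * PowerSeries.X ^ (n - ℓ) * h ℓ, ?_⟩
  rw [LaurentSeries.inverse_coe_X_mul hw, map_sum, ← Finset.sum_sub_distrib]
  refine Finset.sum_congr rfl fun ℓ hℓ => ?_
  rw [← LaurentSeries.single_neg_mul_coe_X_pow_mul (Finset.mem_Icc.mp hℓ).2, ← hh,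
    PowerSeries.coe_sub, PowerSeries.coe_one, PowerSeries.coe_pow, mul_pow,
    HahnSeries.single_pow, ← mul_assoc, HahnSeries.single_mul_single, mul_sub, mul_one]
  simp
end

section
/- Let n ≥ 1 be an integer. The coefficient of X^{n²} in the n-th power (a_n·X^n + a_{n-1}·X^{n-1} + ⋯ + a_1·X)^n equals a_n^n, and for each 1 ≤ j ≤ n−1 there exists a polynomial Q_j ∈ ℤ[A_{n-j+1}, …, A_n] such that for every commutative ring A and all a_1, …, a_n ∈ A, the coefficient of X^{n²−j} in (a_n·X^n + ⋯ + a_1·X)^n equals n·a_n^{n-1}·a_{n-j} + Q_j(a_{n-j+1}, …, a_n). (This is the triangular structure of the system of equations expressing the top n coefficients of the n-th power of a polar part.) -/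
open Polynomial in
theorem coeff_sum_Icc_C_mul_X_pow {A : Type*} [CommRing A] (a : ℕ → A) (k n m : ℕ) :
    (∑ i ∈ Finset.Icc k n, C (a i) * X ^ i).coeff m = if k ≤ m ∧ m ≤ n then a m else 0 := by
  simp [coeff_X_pow]

open Polynomial in
theorem natDegree_sum_Icc_C_mul_X_pow_le {A : Type*} [CommRing A] (a : ℕ → A) (k n : ℕ) :
    (∑ i ∈ Finset.Icc k n, C (a i) * X ^ i).natDegree ≤ n :=
  natDegree_sum_le_of_forall_le _ _ fun _ hi =>
    (natDegree_C_mul_X_pow_le _ _).trans (Finset.mem_Icc.mp hi).2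

open Polynomial in
/-- If `U` has degree at most `n - j` and `T` degree at most `n`, then only the two lowest orders
in `U` contribute to the coefficient of `X ^ (n ^ 2 - j)` in `(U + T) ^ n`. -/
theorem coeff_add_pow_of_natDegree_le {A : Type*} [CommRing A] (U T : A[X]) {n j : ℕ}
    (hj : 1 ≤ j) (hjn : j < n) (hU : U.natDegree ≤ n - j) (hT : T.natDegree ≤ n) :
    ((U + T) ^ n).coeff (n ^ 2 - j)
      = (n : A) * T.coeff n ^ (n - 1) * U.coeff (n - j) + (T ^ n).coeff (n ^ 2 - j) := by
  obtain ⟨N, rfl⟩ : ∃ N, n = N + 2 := ⟨n - 2, by omega⟩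
  obtain ⟨m, hm⟩ : ∃ m, N + 2 = m + j := ⟨N + 2 - j, by omega⟩
  have hmj : N + 2 - j = m := by omega
  rw [hmj] at hU ⊢
  have hexp : (N + 2) ^ 2 - j = m + (N + 1) * (N + 2) := by
    have : (N + 2) ^ 2 = m + (N + 1) * (N + 2) + j := by nlinarith
    omega
  have hmul : (U * T ^ (N + 1)).coeff ((N + 2) ^ 2 - j) = U.coeff m * T.coeff (N + 2) ^ (N + 1) := by
    rw [hexp, coeff_mul_add_eq_of_natDegree_le hU (natDegree_pow_le_of_le _ hT),
      coeff_pow_of_natDegree_le hT]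
  have hhigh : ∀ k ∈ Finset.range (N + 1),
      (U ^ (k + 1 + 1) * T ^ (N + 2 - (k + 1 + 1)) *
        ((N + 2).choose (k + 1 + 1) : A[X])).coeff ((N + 2) ^ 2 - j) = 0 := by
    intro k hk
    obtain ⟨r, rfl⟩ : ∃ r, N = k + r := ⟨N - k, by grind⟩
    rw [← C_eq_natCast, coeff_mul_C, coeff_eq_zero_of_natDegree_lt, zero_mul]
    have hr : k + r + 2 - (k + 1 + 1) = r := by omega
    rw [hexp, hr]
    refine (natDegree_mul_le_of_le (natDegree_pow_le_of_le _ hU)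
      (natDegree_pow_le_of_le _ hT)).trans_lt ?_
    nlinarith
  rw [add_pow, Finset.sum_range_succ', Finset.sum_range_succ', coeff_add, coeff_add,
    finsetSum_coeff, Finset.sum_eq_zero hhigh]
  simp only [zero_add, pow_one, pow_zero, one_mul, Nat.choose_one_right, Nat.choose_zero_right,
    Nat.cast_one, mul_one, Nat.sub_zero, ← C_eq_natCast, coeff_mul_C]
  rw [show N + 2 - 1 = N + 1 from rfl, hmul]
  ring

open Polynomial in
/-- Coefficients of powers of `∑ aᵢ Xⁱ` are universal integral polynomials in the `aᵢ` involved. -/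
theorem exists_supported_aeval_eq_coeff_sum_pow (s : Finset ℕ) (n d : ℕ) :
    ∃ Q : MvPolynomial ℕ ℤ, Q ∈ MvPolynomial.supported ℤ (s : Set ℕ) ∧
      ∀ (A : Type*) [CommRing A] (a : ℕ → A),
        ((∑ i ∈ s, C (a i) * X ^ i) ^ n).coeff d = MvPolynomial.aeval a Q := by
  let q : MvPolynomial (s : Set ℕ) ℤ :=
    ((∑ i : (s : Set ℕ), C (MvPolynomial.X i) * X ^ (i : ℕ)) ^ n).coeff d
  refine ⟨MvPolynomial.rename Subtype.val q, ?_, fun A _ a => ?_⟩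
  · rw [MvPolynomial.supported_eq_range_rename]
    exact ⟨q, rfl⟩
  · rw [MvPolynomial.aeval_rename]
    change _ = (MvPolynomial.aeval (a ∘ Subtype.val) :
      MvPolynomial (s : Set ℕ) ℤ →ₐ[ℤ] A).toRingHom q
    rw [← coeff_map, Polynomial.map_pow, Polynomial.map_sum, ← Finset.sum_coe_sort]
    simp

/-- **Triangular structure of the coefficients of the `n`-th power of a polar part.**
The coefficient of `X^(n²)` in `(aₙXⁿ + ⋯ + a₁X)ⁿ` is `aₙⁿ`, and for `1 ≤ j ≤ n-1` the
coefficient of `X^(n²-j)` equals `n·aₙ^(n-1)·a_{n-j}` plus a universal integral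
polynomial in `a_{n-j+1}, …, aₙ` only. -/
theorem elsv_power_coefficients_triangular (n : ℕ) (hn : 1 ≤ n) :
    (∀ (A : Type*) [CommRing A] (a : ℕ → A),
        ((∑ i ∈ Finset.Icc 1 n, Polynomial.C (a i) * Polynomial.X ^ i) ^ n).coeff (n ^ 2)
          = a n ^ n) ∧
    (∀ j : ℕ, 1 ≤ j → j ≤ n - 1 →
      ∃ Q : MvPolynomial ℕ ℤ,
        Q ∈ MvPolynomial.supported ℤ {i : ℕ | n - j + 1 ≤ i ∧ i ≤ n} ∧
        ∀ (A : Type*) [CommRing A] (a : ℕ → A),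
          ((∑ i ∈ Finset.Icc 1 n,
              Polynomial.C (a i) * Polynomial.X ^ i) ^ n).coeff (n ^ 2 - j)
            = (n : A) * a n ^ (n - 1) * a (n - j) + MvPolynomial.aeval a Q) := by
  refine ⟨fun A _ a => ?_, fun j hj hjn => ?_⟩
  · rw [sq, Polynomial.coeff_pow_of_natDegree_le (natDegree_sum_Icc_C_mul_X_pow_le a 1 n),
      coeff_sum_Icc_C_mul_X_pow, if_pos ⟨hn, le_rfl⟩]
  · obtain ⟨Q, hQ, hQa⟩ :=
      exists_supported_aeval_eq_coeff_sum_pow (Finset.Icc (n - j + 1) n) n (n ^ 2 - j)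
    refine ⟨Q, by rwa [Finset.coe_Icc] at hQ, fun A _ a => ?_⟩
    have hsplit : Finset.Icc 1 n = Finset.Icc 1 (n - j) ∪ Finset.Icc (n - j + 1) n := by
      ext i
      simp only [Finset.mem_union, Finset.mem_Icc]
      omega
    have hdisj : Disjoint (Finset.Icc 1 (n - j)) (Finset.Icc (n - j + 1) n) := by
      rw [Finset.disjoint_left]
      simp only [Finset.mem_Icc]
      omega
    rw [hsplit, Finset.sum_union hdisj,
      coeff_add_pow_of_natDegree_le _ _ hj (by omega)
        (natDegree_sum_Icc_C_mul_X_pow_le a 1 (n - j))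
        (natDegree_sum_Icc_C_mul_X_pow_le a (n - j + 1) n),
      coeff_sum_Icc_C_mul_X_pow, coeff_sum_Icc_C_mul_X_pow,
      if_pos ⟨by omega, le_rfl⟩, if_pos ⟨by omega, le_rfl⟩, hQa]
end

section
/- Let k be an algebraically closed field and n ≥ 1 an integer with n·1 ≠ 0 in k. For all β_0, β_1, …, β_{n-1} ∈ k with β_0 ≠ 0, the set of tuples (a_1, …, a_n) ∈ k^n such that for every 0 ≤ j ≤ n−1 the coefficient of X^{n²−j} in the polynomial (a_n·X^n + a_{n-1}·X^{n-1} + ⋯ + a_1·X)^n equals β_j is finite of cardinality exactly n, and any two solutions differ by the action of an n-th root of unity. (The map sending a polar part of order n to its n-th tensor power is exactly n-to-one away from zero.) -/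
open Polynomial in
/-- A polynomial with nonzero constant term has an `n`-th root modulo every power of `X`, over an
algebraically closed field in which `n` is invertible. -/
theorem exists_X_pow_dvd_pow_sub {k : Type*} [Field k] [IsAlgClosed k] {n : ℕ} (hn : 1 ≤ n)
    (hnk : (n : k) ≠ 0) {B : k[X]} (hB : B.coeff 0 ≠ 0) (m : ℕ) :
    ∃ Q : k[X], X ^ (m + 1) ∣ Q ^ n - B := by
  induction m with
  | zero =>
    obtain ⟨c, hc⟩ := IsAlgClosed.exists_pow_nat_eq (B.coeff 0) (Nat.pos_of_ne_zero (by lia) : 0 < n)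
    refine ⟨C c, ?_⟩
    rw [zero_add, pow_one, X_dvd_iff, ← C_pow]
    simp [hc]
  | succ m ih =>
    obtain ⟨Q, R, hR⟩ := ih
    have hQ : Q.coeff 0 ≠ 0 := by
      intro h
      have h0 := congrArg (eval 0) hR
      simp only [eval_sub, eval_pow, eval_mul, eval_X, ← coeff_zero_eq_eval_zero, h] at h0
      simp [show n ≠ 0 by lia, hB] at h0
    set c : k := -R.coeff 0 / (n * Q.coeff 0 ^ (n - 1)) with hc
    obtain ⟨K, hK⟩ := powAddExpansion Q (C c * X ^ (m + 1)) n
    refine ⟨Q + C c * X ^ (m + 1), ?_⟩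
    have hX : X ∣ R + (n : k[X]) * Q ^ (n - 1) * C c := by
      rw [X_dvd_iff, coeff_zero_eq_eval_zero]
      simp only [eval_add, eval_mul, eval_natCast, eval_pow, eval_C, ← coeff_zero_eq_eval_zero, hc]
      field_simp
      ring
    obtain ⟨T, hT⟩ := hX
    refine ⟨T + K * C c ^ 2 * X ^ m, ?_⟩
    rw [hK]
    linear_combination hR + X ^ (m + 1) * hT

open Polynomial in
/-- Polynomials with the same invertible constant term and the same `n`-th power modulo a power of
`X` agree modulo that power of `X`. -/
theorem X_pow_dvd_sub_of_X_pow_dvd_pow_sub_pow {k : Type*} [Field k] {n m : ℕ}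
    (hnk : (n : k) ≠ 0) {P Q : k[X]} (hP : P.coeff 0 ≠ 0) (hPQ : P.coeff 0 = Q.coeff 0)
    (h : X ^ m ∣ P ^ n - Q ^ n) : X ^ m ∣ P - Q := by
  rw [← (Commute.all P Q).geom_sum₂_mul n] at h
  refine IsCoprime.dvd_of_dvd_mul_left (IsCoprime.pow_left ?_) h
  rw [irreducible_X.coprime_iff_not_dvd, X_dvd_iff, coeff_zero_eq_eval_zero, eval_finsetSum]
  simp only [eval_mul, eval_pow, ← coeff_zero_eq_eval_zero, ← hPQ, ← pow_add]
  rw [Finset.sum_congr rfl fun i hi => by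
    rw [show i + (n - 1 - i) = n - 1 by have := Finset.mem_range.mp hi; lia]]
  simp [hnk, hP]

open Polynomial in
theorem reflect_pow_of_natDegree_le {R : Type*} [CommSemiring R] {p : R[X]} {N : ℕ}
    (hp : p.natDegree ≤ N) (m : ℕ) : reflect (m * N) (p ^ m) = reflect N p ^ m := by
  induction m with
  | zero => simp
  | succ m ih =>
    rw [pow_succ, pow_succ, Nat.succ_mul, reflect_mul _ _ (natDegree_pow_le_of_le m hp) hp, ih]

open Polynomial in
theorem coeff_sum_C_mul_X_pow_succ {R : Type*} [Semiring R] {n : ℕ} (a : Fin n → R) (i : Fin n) :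
    (∑ i : Fin n, C (a i) * X ^ ((i : ℕ) + 1)).coeff (i + 1) = a i := by
  simp [coeff_C_mul, coeff_X_pow, Fin.val_inj]

open Polynomial in
theorem natDegree_sum_C_mul_X_pow_succ_le {R : Type*} [Semiring R] {n : ℕ} (a : Fin n → R) :
    (∑ i : Fin n, C (a i) * X ^ ((i : ℕ) + 1)).natDegree ≤ n :=
  natDegree_sum_le_of_forall_le _ _ fun i _ => (natDegree_C_mul_X_pow_le _ _).trans i.isLt

open Polynomial in
/-- The leading coefficients of `(aₙXⁿ + ⋯ + a₁X)ⁿ` are the trailing coefficients of the `n`-th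
power of the reflected polynomial. -/
theorem coeff_sum_C_mul_X_pow_succ_pow {R : Type*} [CommSemiring R] {n : ℕ} (a : Fin n → R)
    (j : Fin n) :
    ((∑ i : Fin n, C (a i) * X ^ ((i : ℕ) + 1)) ^ n).coeff (n ^ 2 - j) =
      (reflect n (∑ i : Fin n, C (a i) * X ^ ((i : ℕ) + 1)) ^ n).coeff j := by
  rw [← reflect_pow_of_natDegree_le (natDegree_sum_C_mul_X_pow_succ_le a), coeff_reflect,
    revAt_le (by nlinarith [j.isLt]), sq]

open Polynomial in
theorem coeff_reflect_sum_C_mul_X_pow_succ {R : Type*} [Semiring R] {n : ℕ} (a : Fin n → R)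
    (i : Fin n) :
    (reflect n (∑ i : Fin n, C (a i) * X ^ ((i : ℕ) + 1))).coeff i = a i.rev := by
  rw [coeff_reflect, revAt_le i.isLt.le, ← coeff_sum_C_mul_X_pow_succ a i.rev, Fin.val_rev]
  congr 1
  lia

/-- **The `n`-th power map on polar parts of order `n` is exactly `n`-to-one.**
Over an algebraically closed field `k` with `(n : k) ≠ 0`, given targets
`β₀, …, β_{n-1}` with `β₀ ≠ 0`, the set of tuples `(a₁, …, aₙ)` (encoded as
`a : Fin n → k`, with `a i` standing for `a_{i+1}`) such that the coefficient of
`X^(n²-j)` in `(aₙXⁿ + ⋯ + a₁X)ⁿ` equals `β_j` for all `0 ≤ j ≤ n-1` is finite of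
cardinality exactly `n`, and any two solutions differ by scaling by an `n`-th root of
unity. -/
theorem elsv_nth_power_fibers (k : Type*) [Field k] [IsAlgClosed k]
    (n : ℕ) (hn : 1 ≤ n) (hnk : (n : k) ≠ 0) (β : Fin n → k) (hβ : β ⟨0, hn⟩ ≠ 0) :
    letI S : Set (Fin n → k) :=
      {a | ∀ j : Fin n,
        ((∑ i : Fin n, Polynomial.C (a i) * Polynomial.X ^ ((i : ℕ) + 1)) ^ n).coeff
            (n ^ 2 - (j : ℕ)) = β j}
    S.Finite ∧ S.ncard = n ∧
      ∀ a ∈ S, ∀ b ∈ S, ∃ ζ : k, ζ ^ n = 1 ∧ b = fun i => ζ * a i := by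
  set S : Set (Fin n → k) :=
    {a | ∀ j : Fin n,
      ((∑ i : Fin n, Polynomial.C (a i) * Polynomial.X ^ ((i : ℕ) + 1)) ^ n).coeff
          (n ^ 2 - (j : ℕ)) = β j}
  have : NeZero n := ⟨by lia⟩
  have : NeZero (n : k) := ⟨hnk⟩
  let R : (Fin n → k) → Polynomial k := fun a =>
    Polynomial.reflect n (∑ i : Fin n, Polynomial.C (a i) * Polynomial.X ^ ((i : ℕ) + 1))
  have hRS (a) : a ∈ S ↔ ∀ j : Fin n, (R a ^ n).coeff j = β j :=
    forall_congr' fun j => by rw [coeff_sum_C_mul_X_pow_succ_pow]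
  have hR (a) (i : Fin n) : (R a).coeff i = a i.rev := coeff_reflect_sum_C_mul_X_pow_succ a i
  have hRsmul (ζ : k) (a) : R (fun i => ζ * a i) = Polynomial.C ζ * R a := by
    simp only [R, Polynomial.C_mul, mul_assoc, ← Finset.mul_sum, Polynomial.reflect_C_mul]
  have hR0 {a} (ha : a ∈ S) : (R a).coeff 0 ^ n = β ⟨0, hn⟩ := by
    rw [← (hRS a).1 ha ⟨0, hn⟩, Polynomial.coeff_zero_eq_eval_zero,
      Polynomial.coeff_zero_eq_eval_zero, Polynomial.eval_pow]
  have hR0' {a} (ha : a ∈ S) : (R a).coeff 0 ≠ 0 := fun h => hβ <| by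
    rw [← hR0 ha, h, zero_pow (NeZero.ne n)]
  have hsmul {a} (ha : a ∈ S) {ζ : k} (hζ : ζ ^ n = 1) : (fun i => ζ * a i) ∈ S := by
    rw [hRS, hRsmul, mul_pow, ← Polynomial.C_pow, hζ, map_one, one_mul]
    exact (hRS a).1 ha
  have horbit : ∀ a ∈ S, ∀ b ∈ S, ∃ ζ : k, ζ ^ n = 1 ∧ b = fun i => ζ * a i := by
    intro a ha b hb
    have hζ : ((R b).coeff 0 / (R a).coeff 0) ^ n = 1 := by
      rw [div_pow, hR0 ha, hR0 hb, div_self hβ]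
    refine ⟨_, hζ, ?_⟩
    set ζ := (R b).coeff 0 / (R a).coeff 0 with hζ_def
    have hc := hsmul ha hζ
    have hdvd := X_pow_dvd_sub_of_X_pow_dvd_pow_sub_pow (m := n) hnk (hR0' hb)
      (show _ = (R fun i => ζ * a i).coeff 0 by
        rw [hRsmul, Polynomial.coeff_C_mul, hζ_def, div_mul_cancel₀ _ (hR0' ha)])
      (Polynomial.X_pow_dvd_iff.2 fun d hd => by
        rw [Polynomial.coeff_sub, (hRS b).1 hb ⟨d, hd⟩, (hRS _).1 hc ⟨d, hd⟩, sub_self])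
    funext i
    have := Polynomial.X_pow_dvd_iff.1 hdvd i.rev i.rev.isLt
    rwa [Polynomial.coeff_sub, hR, hR, Fin.rev_rev, sub_eq_zero] at this
  obtain ⟨a, ha⟩ : S.Nonempty := by
    have hB (j : Fin n) :
        (∑ i : Fin n, Polynomial.C (β i) * Polynomial.X ^ (i : ℕ)).coeff j = β j := by
      simp [Polynomial.coeff_X_pow, Fin.val_inj]
    obtain ⟨Q, hQ⟩ := exists_X_pow_dvd_pow_sub hn hnk ((hB ⟨0, hn⟩).trans_ne hβ) (n - 1)
    rw [Nat.sub_add_cancel hn] at hQ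
    refine ⟨fun i => Q.coeff i.rev, (hRS _).2 fun j => ?_⟩
    have hRQ : Polynomial.X ^ n ∣ R (fun i => Q.coeff i.rev) - Q :=
      Polynomial.X_pow_dvd_iff.2 fun d hd => by
        rw [Polynomial.coeff_sub, hR _ ⟨d, hd⟩, Fin.rev_rev, sub_self]
    have := Polynomial.X_pow_dvd_iff.1 ((hRQ.trans (sub_dvd_pow_sub_pow _ _ n)).add hQ) j j.isLt
    rwa [sub_add_sub_cancel, Polynomial.coeff_sub, hB, sub_eq_zero] at this
  have hS : S = (fun (ζ : k) i => ζ * a i) '' (Polynomial.nthRootsFinset n (1 : k)) := by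
    ext b
    constructor
    · intro hb
      obtain ⟨ζ, hζ, rfl⟩ := horbit a ha b hb
      exact ⟨ζ, (Polynomial.mem_nthRootsFinset hn 1).2 hζ, rfl⟩
    · rintro ⟨ζ, hζ, rfl⟩
      exact hsmul ha ((Polynomial.mem_nthRootsFinset hn 1).1 hζ)
  have hinj : Function.Injective fun (ζ : k) i => ζ * a i := fun ζ ξ h =>
    mul_right_cancel₀ (hR a ⟨0, hn⟩ ▸ hR0' ha) (congrFun h (Fin.rev ⟨0, hn⟩))
  obtain ⟨ζ, hζ⟩ := HasEnoughRootsOfUnity.exists_primitiveRoot k n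
  refine ⟨hS ▸ (Finset.finite_toSet _).image _, ?_, horbit⟩
  rw [hS, Set.ncard_image_of_injective _ hinj, Set.ncard_coe_finset, hζ.card_nthRootsFinset]
end

section
/- Let B be a commutative ring, t ∈ B a non-zero-divisor, A = B/(t) with quotient map c_0 : B → A, and α ∈ B. Regard A as a B-module through c_0 and let E ⊆ B × A be the B-submodule E = {(b, a) ∈ B × A : c_0(b) = c_0(α)·a}. Then the sequence 0 → B → B ⊕ B → E → 0 is a short exact sequence of B-modules, where the first map sends b to (−α·b, t·b) and the second map sends (b, b′) to (t·b + α·b′, c_0(b′)). (This is the local two-generator presentation of the extension sheaf E_α appearing in the fiberwise description of the stack of stable polar curves.) -/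
/-- **The local two-generator presentation of `E_α`.**
Let `B` be a commutative ring, `t` a non-zero-divisor, `A = B/(t)` with quotient map
`c₀`, and `α ∈ B`.  With `E = {(b, a) ∈ B × A | c₀(b) = c₀(α)·a}`, the sequence
`0 → B → B ⊕ B → E → 0` is short exact, where the first map is `b ↦ (-α·b, t·b)` and the
second is `(b, b′) ↦ (t·b + α·b′, c₀(b′))`. -/
theorem elsv_local_presentation_of_E
    (B : Type*) [CommRing B] (t : B) (ht : t ∈ nonZeroDivisors B) (α : B) :
    letI c₀ := Ideal.Quotient.mk (Ideal.span {t})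
    letI f : B →ₗ[B] B × B :=
      (LinearMap.toSpanSingleton B B (-α)).prod (LinearMap.toSpanSingleton B B t)
    letI g : B × B →ₗ[B] B × (B ⧸ Ideal.span {t}) :=
      (((LinearMap.toSpanSingleton B B t).comp (LinearMap.fst B B B))
          + ((LinearMap.toSpanSingleton B B α).comp (LinearMap.snd B B B))).prod
        ((Algebra.linearMap B (B ⧸ Ideal.span {t})).comp (LinearMap.snd B B B))
    Function.Injective f ∧
      LinearMap.range f = LinearMap.ker g ∧
      Set.range g = {p : B × (B ⧸ Ideal.span {t}) | c₀ p.1 = c₀ α * p.2} := by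
  let c₀ := Ideal.Quotient.mk (Ideal.span {t})
  let f : B →ₗ[B] B × B :=
    (LinearMap.toSpanSingleton B B (-α)).prod (LinearMap.toSpanSingleton B B t)
  let g : B × B →ₗ[B] B × (B ⧸ Ideal.span {t}) :=
    (((LinearMap.toSpanSingleton B B t).comp (LinearMap.fst B B B))
        + ((LinearMap.toSpanSingleton B B α).comp (LinearMap.snd B B B))).prod
      ((Algebra.linearMap B (B ⧸ Ideal.span {t})).comp (LinearMap.snd B B B))
  change Function.Injective f ∧ LinearMap.range f = LinearMap.ker g ∧
    Set.range g = {p : B × (B ⧸ Ideal.span {t}) | c₀ p.1 = c₀ α * p.2}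
  have hf (b : B) : f b = (b * -α, b * t) := rfl
  have hg (x y : B) : g (x, y) = (x * t + y * α, c₀ y) := rfl
  have hc (y : B) : c₀ y = 0 ↔ ∃ c, y = t * c := by
    rw [Ideal.Quotient.eq_zero_iff_mem, Ideal.mem_span_singleton, dvd_def]
  refine ⟨fun a b h ↦ ?_, ?_, ?_⟩
  · rw [hf, hf, Prod.mk.injEq] at h
    exact (mul_cancel_right_mem_nonZeroDivisors ht).mp h.2
  · ext ⟨x, y⟩
    rw [LinearMap.mem_range, LinearMap.mem_ker, hg, Prod.mk_eq_zero, hc]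
    constructor
    · rintro ⟨b, h⟩
      rw [hf, Prod.mk.injEq] at h
      obtain ⟨rfl, rfl⟩ := h
      exact ⟨by ring, b, mul_comm b t⟩
    · rintro ⟨h, c, rfl⟩
      refine ⟨c, ?_⟩
      rw [hf, Prod.mk.injEq]
      refine ⟨(mul_cancel_right_mem_nonZeroDivisors ht).mp ?_, mul_comm c t⟩
      linear_combination -h
  · ext ⟨b, a⟩
    rw [Set.mem_range, Set.mem_ofPred_eq]
    constructor
    · rintro ⟨⟨x, y⟩, h⟩
      rw [hg, Prod.mk.injEq] at h
      obtain ⟨rfl, rfl⟩ := h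
      rw [← map_mul, ← sub_eq_zero, ← map_sub, hc]
      exact ⟨x, by ring⟩
    · intro h
      obtain ⟨y, rfl⟩ := Ideal.Quotient.mk_surjective a
      change c₀ b = c₀ α * c₀ y at h
      rw [← map_mul, ← sub_eq_zero, ← map_sub, hc] at h
      obtain ⟨x, hx⟩ := h
      refine ⟨(x, y), ?_⟩
      rw [hg, Prod.mk.injEq]
      exact ⟨by linear_combination -hx, rfl⟩
end
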